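/- arXiv:2604.12070 — 2 statements merged into one kernel-verified Lean document; each statement's English description precedes it below -/
import Mathlib

section
/- Dantzig–Wolfe equivalence of the LP bounds: the set of attainable master-LP objective values equals the set of attainable objective values of the convexified compact LP, i.e., {obj(λ) : λ feasible for the master LP} = {∑_{i∈I} ∑_{j∈J} c i j · (x i) j : families (x i)_{i∈I} with x i ∈ convexHull ℝ (P i) for every i ∈ I and ∑_{i∈I} (x i) j = 1 for every j ∈ J}. -/
open Finset

/-- Dantzig–Wolfe equivalence of the LP bounds: the set of attainable master-LP
objective values equals the set of attainable objective values of the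
convexified compact LP. -/
theorem dantzig_wolfe_equivalence
    {I J : Type*} [Fintype I] [Fintype J] [Nonempty I] [Nonempty J]
    (c : I → J → ℝ) (P : I → Finset (J → ℝ))
    (hP : ∀ i, (P i).Nonempty)
    (hbin : ∀ i, ∀ v ∈ P i, ∀ j, v j = 0 ∨ v j = 1) :
    {y : ℝ | ∃ lam : I → (J → ℝ) → ℝ,
        (∀ i, ∀ v ∈ P i, 0 ≤ lam i v) ∧
        (∀ j, ∑ i, ∑ v ∈ P i, v j * lam i v = 1) ∧
        (∀ i, ∑ v ∈ P i, lam i v = 1) ∧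
        y = ∑ i, ∑ v ∈ P i, (∑ j, c i j * v j) * lam i v}
      =
    {y : ℝ | ∃ x : I → (J → ℝ),
        (∀ i, x i ∈ convexHull ℝ ((P i : Set (J → ℝ)))) ∧
        (∀ j, ∑ i, x i j = 1) ∧
        y = ∑ i, ∑ j, c i j * x i j} := by
  have key : ∀ (lam : I → (J → ℝ) → ℝ) (i : I) (j : J),
      (∑ v ∈ P i, lam i v • v) j = ∑ v ∈ P i, v j * lam i v := by
    intro lam i j
    rw [Finset.sum_apply]
    exact Finset.sum_congr rfl fun v _ => by simp [mul_comm]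
  have obj : ∀ (lam : I → (J → ℝ) → ℝ),
      ∑ i, ∑ v ∈ P i, (∑ j, c i j * v j) * lam i v
        = ∑ i, ∑ j, c i j * (∑ v ∈ P i, lam i v • v) j := by
    intro lam
    refine Finset.sum_congr rfl fun i _ => ?_
    simp_rw [key, Finset.sum_mul, Finset.mul_sum]
    rw [Finset.sum_comm]
    simp_rw [mul_assoc]
  ext y
  constructor
  · rintro ⟨lam, h0, hpart, hconv, rfl⟩
    refine ⟨fun i => ∑ v ∈ P i, lam i v • v, fun i => ?_, fun j => ?_, obj lam⟩
    · exact Finset.mem_convexHull'.2 ⟨lam i, h0 i, hconv i, rfl⟩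
    · simp_rw [key]
      exact hpart j
  · rintro ⟨x, hx, hpart, rfl⟩
    choose lam h0 hconv hsum using fun i => Finset.mem_convexHull'.1 (hx i)
    refine ⟨lam, h0, fun j => ?_, hconv, ?_⟩
    · simp_rw [← key, hsum]
      exact hpart j
    · rw [obj]
      simp_rw [hsum]
end

section
/- Strong duality between the Lagrangian dual and the Dantzig–Wolfe master LP: if there exists at least one weight family λ feasible for the master LP, then sSup {L(π) : π : J → ℝ} = sInf {obj(λ) : λ feasible for the master LP}; that is, the best Lagrangian bound obtained by dualizing the set-partitioning constraints coincides with the optimal value of the column-generation master LP. -/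
open Finset

/-- Strong half of the duality: any value strictly below all convexified objective values is
exceeded by some Lagrangian dual value. -/
theorem exists_dual_gt {I J : Type*} [Fintype I] [Fintype J]
    (c : I → J → ℝ) (P : I → Finset (J → ℝ)) (hP : ∀ i, (P i).Nonempty)
    (w0 : I → J → ℝ) (hw0 : ∀ i, w0 i ∈ convexHull ℝ (P i : Set (J → ℝ)))
    (hw01 : ∀ j, ∑ i, w0 i j = 1) (z : ℝ)
    (hz : ∀ w : I → J → ℝ, (∀ i, w i ∈ convexHull ℝ (P i : Set (J → ℝ))) →
      (∀ j, ∑ i, w i j = 1) → z < ∑ i, ∑ j, c i j * w i j) :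
    ∃ π : J → ℝ, z < (∑ j, π j) +
          ∑ i, (P i).inf' (hP i) (fun v => ∑ j, (c i j - π j) * v j) := by
  classical
  let Φ : (I → J → ℝ) →ₗ[ℝ] (J → ℝ) × ℝ :=
    { toFun := fun w => (fun j => ∑ i, w i j, ∑ i, ∑ j, c i j * w i j)
      map_add' := by
        intro x y
        ext <;> simp [Finset.sum_add_distrib, mul_add]
      map_smul' := by
        intro r x
        ext <;> simp [Finset.mul_sum, mul_left_comm] }
  let K : Set (I → J → ℝ) := Set.univ.pi fun i => convexHull ℝ (P i : Set (J → ℝ))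
  have hKc : IsCompact K := isCompact_univ_pi fun i => (P i).finite_toSet.isCompact_convexHull (𝕜 := ℝ)
  have hKv : Convex ℝ K := convex_pi fun i _ => convex_convexHull ℝ _
  have hΦ : Continuous Φ := Φ.continuous_of_finiteDimensional
  have hS : IsCompact (Φ '' K) := hKc.image hΦ
  have hSv : Convex ℝ (Φ '' K) := hKv.linear_image Φ
  have hnot : ((fun _ => 1, z) : (J → ℝ) × ℝ) ∉ Φ '' K := by
    rintro ⟨w, hw, h⟩
    have h1 : (fun j => ∑ i, w i j) = fun _ => (1 : ℝ) := congrArg Prod.fst h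
    have h2 : ∑ i, ∑ j, c i j * w i j = z := congrArg Prod.snd h
    exact absurd (hz w (fun i => hw i trivial) (fun j => congrFun h1 j)) (by rw [h2]; exact lt_irrefl z)
  obtain ⟨f, u, hf1, hf2⟩ := geometric_hahn_banach_closed_point hSv hS.isClosed hnot
  set a : J → ℝ := fun j => f (Pi.single j 1, 0) with ha
  set b : ℝ := f (0, 1) with hb
  have hf : ∀ (x : J → ℝ) (t : ℝ), f (x, t) = ∑ j, x j * a j + t * b := by
    intro x t
    have e : ((x, t) : (J → ℝ) × ℝ) = ∑ j, x j • ((Pi.single j 1, 0) : (J → ℝ) × ℝ)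
        + t • ((0, 1) : (J → ℝ) × ℝ) := by
      refine Prod.ext ?_ ?_
      · funext k
        simp [Prod.fst_sum, Finset.sum_apply, Pi.single_apply]
      · simp [Prod.snd_sum]
    rw [e, map_add, map_sum, map_smul]
    simp only [map_smul, smul_eq_mul, ha, hb]
  have key : ∀ w : I → J → ℝ, (∀ i, w i ∈ convexHull ℝ (P i : Set (J → ℝ))) →
      ∑ j, (∑ i, w i j) * a j + (∑ i, ∑ j, c i j * w i j) * b < ∑ j, a j + z * b := by
    intro w hw
    have h1 := (hf1 (Φ w) ⟨w, fun i _ => hw i, rfl⟩).trans hf2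
    have h2 : Φ w = (fun j => ∑ i, w i j, ∑ i, ∑ j, c i j * w i j) := rfl
    rw [h2, hf, hf] at h1
    simpa using h1
  have hbneg : b < 0 := by
    have h1 := key w0 hw0
    simp only [hw01, one_mul] at h1
    have h2 := hz w0 hw0 hw01
    nlinarith
  choose m hm hme using fun i => (P i).exists_mem_eq_inf' (hP i)
    (fun v => ∑ j, (c i j - a j / (-b)) * v j)
  refine ⟨fun j => a j / (-b), ?_⟩
  simp only [hme]
  have h1 := key m fun i => subset_convexHull ℝ _ (hm i)
  have h3 : ∑ i, ∑ j, (c i j - a j / (-b)) * m i j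
      = ∑ i, ∑ j, c i j * m i j - (∑ j, (∑ i, m i j) * a j) / (-b) := by
    simp only [sub_mul, Finset.sum_sub_distrib]
    congr 1
    rw [Finset.sum_comm, Finset.sum_div]
    refine Finset.sum_congr rfl fun j _ => ?_
    rw [← Finset.mul_sum]; ring
  rw [h3, ← Finset.sum_div]
  have hb' : 0 < -b := by linarith
  have h4 : z < (∑ j, a j - ∑ j, (∑ i, m i j) * a j) / (-b) + ∑ i, ∑ j, c i j * m i j := by
    rw [← sub_lt_iff_lt_add, lt_div_iff₀ hb']
    nlinarith
  rw [sub_div] at h4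
  linarith

/-- Strong duality between the Lagrangian dual and the Dantzig–Wolfe master LP:
if the master LP is feasible, the supremum of the Lagrangian dual values equals
the infimum of the master-LP objective values. -/
theorem strong_duality_lagrangian_master
    {I J : Type*} [Fintype I] [Fintype J] [Nonempty I] [Nonempty J]
    (c : I → J → ℝ) (P : I → Finset (J → ℝ))
    (hP : ∀ i, (P i).Nonempty)
    (hbin : ∀ i, ∀ v ∈ P i, ∀ j, v j = 0 ∨ v j = 1)
    (hfeas : ∃ lam : I → (J → ℝ) → ℝ,
        (∀ i, ∀ v ∈ P i, 0 ≤ lam i v) ∧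
        (∀ j, ∑ i, ∑ v ∈ P i, v j * lam i v = 1) ∧
        (∀ i, ∑ v ∈ P i, lam i v = 1)) :
    sSup {y : ℝ | ∃ π : J → ℝ,
        y = (∑ j, π j) +
          ∑ i, (P i).inf' (hP i) (fun v => ∑ j, (c i j - π j) * v j)}
      =
    sInf {y : ℝ | ∃ lam : I → (J → ℝ) → ℝ,
        (∀ i, ∀ v ∈ P i, 0 ≤ lam i v) ∧
        (∀ j, ∑ i, ∑ v ∈ P i, v j * lam i v = 1) ∧
        (∀ i, ∑ v ∈ P i, lam i v = 1) ∧
        y = ∑ i, ∑ v ∈ P i, (∑ j, c i j * v j) * lam i v} := by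
  have weak : ∀ (π : J → ℝ) (lam : I → (J → ℝ) → ℝ),
      (∀ i, ∀ v ∈ P i, 0 ≤ lam i v) →
      (∀ j, ∑ i, ∑ v ∈ P i, v j * lam i v = 1) →
      (∀ i, ∑ v ∈ P i, lam i v = 1) →
      (∑ j, π j) + ∑ i, (P i).inf' (hP i) (fun v => ∑ j, (c i j - π j) * v j)
        ≤ ∑ i, ∑ v ∈ P i, (∑ j, c i j * v j) * lam i v := by
    intro π lam h0 h1 h2
    have hA : ∀ i, (P i).inf' (hP i) (fun v => ∑ j, (c i j - π j) * v j)
        ≤ ∑ v ∈ P i, (∑ j, (c i j - π j) * v j) * lam i v := by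
      intro i
      calc _ = ∑ v ∈ P i, (P i).inf' (hP i) (fun v => ∑ j, (c i j - π j) * v j) * lam i v := by
            rw [← Finset.mul_sum, h2, mul_one]
        _ ≤ _ := Finset.sum_le_sum fun v hv =>
            mul_le_mul_of_nonneg_right
              (Finset.inf'_le (fun v => ∑ j, (c i j - π j) * v j) hv) (h0 i v hv)
    have hB : ∑ j, π j = ∑ i, ∑ v ∈ P i, (∑ j, π j * v j) * lam i v := by
      calc ∑ j, π j = ∑ j, π j * ∑ i, ∑ v ∈ P i, v j * lam i v := by simp [h1]
        _ = ∑ i, ∑ v ∈ P i, ∑ j, π j * v j * lam i v := by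
            simp only [Finset.mul_sum]
            rw [Finset.sum_comm]
            refine Finset.sum_congr rfl fun i _ => ?_
            rw [Finset.sum_comm]
            simp only [mul_assoc]
        _ = _ := by simp only [Finset.sum_mul]
    have hC := Finset.sum_le_sum fun i (_ : i ∈ (Finset.univ : Finset I)) => hA i
    simp only [sub_mul, Finset.sum_sub_distrib] at hC hB ⊢
    linarith
  obtain ⟨l0, hl0, hl1, hl2⟩ := hfeas
  apply le_antisymm
  · refine csSup_le ⟨_, fun _ => 0, rfl⟩ ?_
    rintro _ ⟨π, rfl⟩
    refine le_csInf ⟨_, l0, hl0, hl1, hl2, rfl⟩ ?_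
    rintro _ ⟨lam, h0, h1, h2, rfl⟩
    exact weak π lam h0 h1 h2
  · apply le_of_forall_lt
    intro z hz
    obtain ⟨π, hπ⟩ := exists_dual_gt c P hP (fun i => ∑ v ∈ P i, l0 i v • v)
      (fun i => Finset.mem_convexHull'.2 ⟨l0 i, hl0 i, hl2 i, rfl⟩)
      (fun j => by simpa [Finset.sum_apply, mul_comm] using hl1 j) z (by
        intro w hw hw1
        choose lam h0 h2 hlw using fun i => Finset.mem_convexHull'.1 (hw i)
        have hwj : ∀ i j, w i j = ∑ v ∈ P i, v j * lam i v := by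
          intro i j
          rw [← hlw i]
          simp [Finset.sum_apply, mul_comm]
        refine hz.trans_le (csInf_le ?_ ⟨lam, h0, ?_, h2, ?_⟩)
        · refine ⟨(∑ j : J, (fun _ => (0 : ℝ)) j) + ∑ i, (P i).inf' (hP i)
            (fun v => ∑ j, (c i j - (fun _ => (0 : ℝ)) j) * v j), ?_⟩
          rintro _ ⟨lam, h0, h1, h2, rfl⟩
          exact weak (fun _ => 0) lam h0 h1 h2
        · intro j
          simpa only [hwj] using hw1 j
        · refine Finset.sum_congr rfl fun i _ => ?_
          simp only [hwj, Finset.mul_sum, Finset.sum_mul]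
          rw [Finset.sum_comm]
          simp only [mul_assoc])
    refine hπ.trans_le (le_csSup ?_ ⟨π, rfl⟩)
    refine ⟨∑ i, ∑ v ∈ P i, (∑ j, c i j * v j) * l0 i v, ?_⟩
    rintro _ ⟨π, rfl⟩
    exact weak π l0 hl0 hl1 hl2
end
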